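/- arXiv:2605.03349 — 2 statements merged into one kernel-verified Lean document; each statement's English description precedes it below -/
import Mathlib

section
/- For every ε > 0 there exists Q₀ such that for every prime q ≥ Q₀ and every integer a coprime to q, there exist positive integers n, m ≤ q^{5/2+ε} with n ≡ a (mod q), m ≡ a (mod q), λ(n) = -1 and λ(m) = +1. -/
/-- The Liouville function `λ(n) = (-1)^Ω(n)`, where `Ω(n)` is the number of prime
factors of `n` counted with multiplicity. -/
def liouville (n : ℕ) : ℤ := (-1) ^ (ArithmeticFunction.cardFactors n)

theorem liouville_mul {m n : ℕ} (hm : m ≠ 0) (hn : n ≠ 0) :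
    liouville (m * n) = liouville m * liouville n := by
  simp [liouville, ArithmeticFunction.cardFactors_mul hm hn, pow_add]

theorem liouville_ne_zero (n : ℕ) : liouville n ≠ 0 := by
  simp [liouville]

theorem liouville_eq_one_or_neg_one (n : ℕ) : liouville n = 1 ∨ liouville n = -1 :=
  neg_one_pow_eq_or ℤ _

theorem liouville_prime {p : ℕ} (hp : p.Prime) : liouville p = -1 := by
  simp [liouville, ArithmeticFunction.cardFactors_apply_prime hp]

theorem natCast_zmod_ne_zero {q m : ℕ} (hm : 0 < m) (hmq : m < q) : (m : ZMod q) ≠ 0 := by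
  rw [Ne, ZMod.natCast_eq_zero_iff]
  exact Nat.not_dvd_of_pos_of_lt hm hmq

/-- Every prime `q ≥ 11` has a smaller prime that is a quadratic residue modulo `q`. -/
theorem exists_prime_lt_isSquare {q : ℕ} (hq : q.Prime) (hq11 : 11 ≤ q) :
    ∃ p : ℕ, p.Prime ∧ p < q ∧ IsSquare (p : ZMod q) := by
  have : Fact q.Prime := ⟨hq⟩
  have hq2 : q ≠ 2 := by lia
  have hodd : q % 2 = 1 := hq.eq_two_or_odd.resolve_left hq2
  have h_two (h : q % 8 = 1 ∨ q % 8 = 7) :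
      ∃ p : ℕ, p.Prime ∧ p < q ∧ IsSquare (p : ZMod q) :=
    ⟨2, Nat.prime_two, by lia, by exact_mod_cast (ZMod.exists_sq_eq_two_iff hq2).2 h⟩
  have h_eight {k : ℕ} (hk : 10 ≤ 2 ^ k) : 8 ∣ 2 ^ k := by
    have : 3 ≤ k := by
      by_contra! h
      interval_cases k <;> simp at hk
    exact pow_dvd_pow 2 this
  rcases (by lia : q % 4 = 1 ∨ q % 4 = 3) with h4 | h4
  · rcases (q - 1).eq_two_pow_or_exists_odd_prime_and_dvd with ⟨k, hk⟩ | ⟨p, hp, hdvd, hpo⟩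
    · have := h_eight (k := k) (by lia)
      exact h_two (by lia)
    · have : Fact p.Prime := ⟨hp⟩
      have hp2 : p ≠ 2 := by rintro rfl; exact absurd hpo (by decide)
      have hle := Nat.le_of_dvd (by lia) hdvd
      refine ⟨p, hp, by lia, (ZMod.exists_sq_eq_prime_iff_of_mod_four_eq_one h4 hp2).2 ?_⟩
      have h0 : ((q - 1 : ℕ) : ZMod p) = 0 := (ZMod.natCast_eq_zero_iff _ _).2 hdvd
      rw [Nat.cast_sub (by lia), Nat.cast_one, sub_eq_zero] at h0
      rw [h0]
      exact IsSquare.one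
  · rcases (q + 1).eq_two_pow_or_exists_odd_prime_and_dvd with ⟨k, hk⟩ | ⟨p, hp, hdvd, hpo⟩
    · have := h_eight (k := k) (by lia)
      exact h_two (by lia)
    · have : Fact p.Prime := ⟨hp⟩
      have hp2 : p ≠ 2 := by rintro rfl; exact absurd hpo (by decide)
      have hlt : p < q := by
        obtain ⟨c, hc⟩ := hdvd
        have hc1 : c ≠ 1 := by
          rintro rfl
          rw [Nat.odd_iff] at hpo
          lia
        have : c ≠ 0 := by rintro rfl; simp at hc
        have : 2 ≤ c := by lia
        nlinarith
      refine ⟨p, hp, hlt, ?_⟩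
      have h0 : ((q + 1 : ℕ) : ZMod p) = 0 := (ZMod.natCast_eq_zero_iff _ _).2 hdvd
      have hneg : (q : ZMod p) = -1 := by
        rw [Nat.cast_add, Nat.cast_one] at h0
        exact eq_neg_of_add_eq_zero_left h0
      rw [Nat.odd_iff] at hpo
      rcases (by lia : p % 4 = 1 ∨ p % 4 = 3) with hp4 | hp4
      · apply (ZMod.exists_sq_eq_prime_iff_of_mod_four_eq_one hp4 hq2).1
        rw [hneg]
        exact ZMod.exists_sq_eq_neg_one_iff.2 (by lia)
      · by_contra hns
        have := (ZMod.exists_sq_eq_prime_iff_of_mod_four_eq_three hp4 h4 hlt.ne).2 hns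
        rw [hneg] at this
        exact ZMod.exists_sq_eq_neg_one_iff.1 this hp4

/-- If `liouville` is periodic modulo `q` on the integers up to `q * (√q + 1)` coprime to `q`,
then it is multiplicative on the nonzero residues. -/
theorem liouville_val_mul_of_periodic {q : ℕ} (hq : q.Prime)
    (hper : ∀ b : ℕ, (b : ZMod q) ≠ 0 → b ≤ q * (q.sqrt + 1) →
      liouville b = liouville (b : ZMod q).val)
    (m : ℕ) (hm : 0 < m) (hmq : m < q) (x : ZMod q) (hx : x ≠ 0) :
    liouville (m * x).val = liouville m * liouville x.val := by
  have : Fact q.Prime := ⟨hq⟩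
  induction m using Nat.strong_induction_on generalizing x with
  | _ m ih =>
  have hm0 : (m : ZMod q) ≠ 0 := natCast_zmod_ne_zero hm hmq
  rcases le_or_gt m (q.sqrt + 1) with hle | hlt
  · have hcast : ((m * x.val : ℕ) : ZMod q) = m * x := by simp
    rw [← hcast, ← hper, liouville_mul hm.ne' ((ZMod.val_ne_zero x).2 hx)]
    · rw [hcast]; exact mul_ne_zero hm0 hx
    · rw [mul_comm]
      exact Nat.mul_le_mul (ZMod.val_lt x).le hle
  · set k := q / m + 1 with hk
    have hkle : k ≤ q.sqrt + 1 := by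
      have : q / m < q.sqrt + 1 := by
        rw [Nat.div_lt_iff_lt_mul hm]
        have := Nat.lt_succ_sqrt q
        simp only [Nat.succ_eq_add_one] at this
        nlinarith
      lia
    have hkm : k < m := by lia
    have hmod : 0 < q % m := by
      rw [Nat.pos_iff_ne_zero]
      intro h
      rcases (Nat.dvd_prime hq).1 (Nat.dvd_of_mod_eq_zero h) with h | h <;> lia
    have hdiv := Nat.div_add_mod q m
    have hmodlt := Nat.mod_lt q hm
    have hkmul : k * m = q + (m - q % m) := by
      rw [hk, add_mul, one_mul, mul_comm]
      lia
    set w := m - q % m with hw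
    have hcast : (k : ZMod q) * m = w := by
      have := congrArg (Nat.cast : ℕ → ZMod q) hkmul
      simpa using this
    have h_kmx := ih k hkm (by lia) (by lia) (m * x) (mul_ne_zero hm0 hx)
    have h_km := ih k hkm (by lia) (by lia) m hm0
    have h_wx := ih w (by lia) (by lia) (by lia) x hx
    rw [← mul_assoc, hcast, h_wx] at h_kmx
    rw [hcast, ZMod.val_natCast_of_lt (by lia), ZMod.val_natCast_of_lt hmq] at h_km
    rw [h_km, mul_assoc] at h_kmx
    exact (mul_left_cancel₀ (liouville_ne_zero k) h_kmx).symm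

theorem exists_liouville_ne_liouville_val {q : ℕ} (hq : q.Prime) (hq11 : 11 ≤ q) :
    ∃ b : ℕ, (b : ZMod q) ≠ 0 ∧ b ≤ q * (q.sqrt + 1) ∧
      liouville b ≠ liouville (b : ZMod q).val := by
  by_contra! hper
  have : Fact q.Prime := ⟨hq⟩
  obtain ⟨p, hp, hpq, y, hy⟩ := exists_prime_lt_isSquare hq hq11
  have hp0 : (p : ZMod q) ≠ 0 := natCast_zmod_ne_zero hp.pos hpq
  have hy0 : y ≠ 0 := by
    rintro rfl
    simp [hp0] at hy
  have hmul := liouville_val_mul_of_periodic hq hper y.val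
    (Nat.pos_of_ne_zero ((ZMod.val_ne_zero y).2 hy0)) (ZMod.val_lt y) y hy0
  rw [ZMod.natCast_zmod_val, ← hy, ZMod.val_natCast_of_lt hpq, liouville_prime hp] at hmul
  nlinarith [mul_self_nonneg (liouville y.val)]

theorem exists_liouville_eq {q : ℕ} (hq : q.Prime) (hq11 : 11 ≤ q) {a : ℤ}
    (ha : (a : ZMod q) ≠ 0) {s : ℤ} (hs : s = 1 ∨ s = -1) :
    ∃ n : ℕ, 0 < n ∧ n ≤ q * q * (q.sqrt + 1) ∧ (n : ℤ) ≡ a [ZMOD (q : ℤ)] ∧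
      liouville n = s := by
  have : Fact q.Prime := ⟨hq⟩
  by_contra! hne
  have hconst (n : ℕ) (hn : 0 < n) (hle : n ≤ q * q * (q.sqrt + 1)) (hna : (n : ZMod q) = a) :
      liouville n = -s := by
    have := hne n hn hle ((ZMod.intCast_eq_intCast_iff _ _ _).1 (by simpa using hna))
    rcases liouville_eq_one_or_neg_one n with h | h <;> lia
  obtain ⟨b, hb0, hble, hb⟩ := exists_liouville_ne_liouville_val hq hq11
  set c : ZMod q := a * (b : ZMod q)⁻¹ with hc
  have hc0 : c.val ≠ 0 := (ZMod.val_ne_zero c).2 (mul_ne_zero ha (inv_ne_zero hb0))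
  have hprod (d : ℕ) (hd : (d : ZMod q) = b) (hdle : d ≤ q * (q.sqrt + 1)) :
      liouville d * liouville c.val = -s := by
    have hd0 : d ≠ 0 := by
      rintro rfl
      exact hb0 (by simpa using hd.symm)
    rw [← liouville_mul hd0 hc0]
    refine hconst _ (by positivity) ?_ ?_
    · rw [mul_comm, mul_assoc]
      exact Nat.mul_le_mul (ZMod.val_lt c).le hdle
    · rw [Nat.cast_mul, ZMod.natCast_zmod_val, hd, hc]
      field_simp
  refine hb (mul_right_cancel₀ (liouville_ne_zero c.val) ?_)
  rw [hprod b rfl hble, hprod _ (ZMod.natCast_zmod_val _)]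
  exact (ZMod.val_lt _).le.trans (Nat.le_mul_of_pos_right q (by lia))

theorem mul_sqrt_add_one_le_rpow {ε : ℝ} {q : ℕ} (hq : 1 ≤ q) (h2 : 2 ≤ (q : ℝ) ^ ε) :
    ((q * q * (q.sqrt + 1) : ℕ) : ℝ) ≤ (q : ℝ) ^ ((5 : ℝ) / 2 + ε) := by
  have hq1 : (1 : ℝ) ≤ q := by exact_mod_cast hq
  have hq0 : (0 : ℝ) < q := by linarith
  have hsqrt : (q.sqrt : ℝ) ≤ √q := Real.nat_sqrt_le_real_sqrt
  have hone : 1 ≤ √(q : ℝ) := Real.one_le_sqrt.2 hq1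
  have hsplit : (q : ℝ) ^ ((5 : ℝ) / 2 + ε) = q * q * (√q * q ^ ε) := by
    rw [show (5 : ℝ) / 2 + ε = 2 + 1 / 2 + ε by ring, Real.rpow_add hq0, Real.rpow_add hq0,
      ← Real.sqrt_eq_rpow, Real.rpow_two]
    ring
  rw [hsplit]
  push_cast
  gcongr
  nlinarith

theorem liouville_both_signs_in_progressions :
    ∀ ε : ℝ, 0 < ε → ∃ Q₀ : ℕ, ∀ q : ℕ, q.Prime → Q₀ ≤ q →
      ∀ a : ℤ, Int.gcd a q = 1 →
        ∃ n m : ℕ, 0 < n ∧ 0 < m ∧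
          (n : ℝ) ≤ (q : ℝ) ^ ((5 : ℝ) / 2 + ε) ∧
          (m : ℝ) ≤ (q : ℝ) ^ ((5 : ℝ) / 2 + ε) ∧
          (n : ℤ) ≡ a [ZMOD (q : ℤ)] ∧ (m : ℤ) ≡ a [ZMOD (q : ℤ)] ∧
          liouville n = -1 ∧ liouville m = 1 := by
  intro ε hε
  obtain ⟨N, hN⟩ := Filter.eventually_atTop.1
    (((tendsto_rpow_atTop hε).comp tendsto_natCast_atTop_atTop).eventually_ge_atTop (2 : ℝ))
  refine ⟨max N 11, fun q hq hQ a ha => ?_⟩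
  have hq11 : 11 ≤ q := (le_max_right N 11).trans hQ
  have hbound := mul_sqrt_add_one_le_rpow hq.one_le (hN q ((le_max_left N 11).trans hQ))
  have ha0 : (a : ZMod q) ≠ 0 := by
    rw [Ne, ZMod.intCast_zmod_eq_zero_iff_dvd]
    intro h
    have hdvd := Int.dvd_coe_gcd h (dvd_refl (q : ℤ))
    rw [ha] at hdvd
    exact hq.one_lt.ne' (Nat.dvd_one.1 (by exact_mod_cast hdvd))
  obtain ⟨n, hn, hnle, hna, hns⟩ := exists_liouville_eq hq hq11 ha0 (Or.inr rfl)
  obtain ⟨m, hm, hmle, hma, hms⟩ := exists_liouville_eq hq hq11 ha0 (Or.inl rfl)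
  exact ⟨n, m, hn, hm, le_trans (by exact_mod_cast hnle) hbound,
    le_trans (by exact_mod_cast hmle) hbound, hna, hma, hns, hms⟩
end

section
/- Let q be a prime, δ > 0, C > 0 and L ≥ q. Suppose: (i) #{1 ≤ n ≤ q : gcd(n,q) = 1, λ(n) ≠ χ_q(n)} ≤ C·q^{1-δ}; and (ii) λ(n + q) = λ(n) for every positive integer n ≤ L with gcd(n, q) = 1. For N, R ≥ 1 set E(N) = #{primes p : N/2 < p ≤ N, χ_q(p) = 1} and Q⁻_R = {primes r : R/2 < r ≤ R, χ_q(r) = -1}. Then there is a constant C' depending only on C such that E(N)·|Q⁻_R| ≤ C'·R·N·q^{-δ} whenever q ≤ N·R ≤ L. -/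
open scoped BigOperators

/-- The Liouville function is `1` on products of two primes. -/
lemma liouville_prime_mul_prime {p r : ℕ} (hp : p.Prime) (hr : r.Prime) :
    liouville (p * r) = 1 := by
  simp [liouville, ArithmeticFunction.cardFactors_mul hp.ne_zero hr.ne_zero,
    ArithmeticFunction.cardFactors_apply_prime hp, ArithmeticFunction.cardFactors_apply_prime hr]

lemma liouville_add_mul_of_periodic {q : ℕ} {L : ℝ}
    (hper : ∀ n : ℕ, 0 < n → (n : ℝ) ≤ L → n.Coprime q → liouville (n + q) = liouville n)
    {m : ℕ} (hm : 0 < m) (hmq : m.Coprime q) (k : ℕ) (hk : ((m + q * k : ℕ) : ℝ) ≤ L) :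
    liouville (m + q * k) = liouville m := by
  induction k with
  | zero => simp
  | succ k ih =>
    have hle : ((m + q * k : ℕ) : ℝ) ≤ L :=
      le_trans (by exact_mod_cast (by gcongr; omega)) hk
    rw [mul_add_one, ← add_assoc, hper _ (by omega) hle (by simpa using hmq), ih hle]

lemma eq_and_eq_of_prime_mul_eq {p r p' r' : ℕ} (hp : p.Prime) (hp' : p'.Prime) (hr' : r'.Prime)
    (hne : p ≠ r') (h : p * r = p' * r') : p = p' ∧ r = r' := by
  have hpp : p = p' := by
    rcases (Nat.Prime.dvd_mul hp).1 (h ▸ dvd_mul_right p r) with h1 | h1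
    · exact (Nat.prime_dvd_prime_iff_eq hp hp').1 h1
    · exact absurd ((Nat.prime_dvd_prime_iff_eq hp hr').1 h1) hne
  subst hpp
  exact ⟨rfl, Nat.eq_of_mul_eq_mul_left hp.pos h⟩

open Classical in
theorem split_times_inert_prime_count_bound
    (C : ℝ) (hC : 0 < C) :
    ∃ C' : ℝ, 0 < C' ∧ ∀ q : ℕ, q.Prime → ∀ δ : ℝ, 0 < δ →
      ∀ L : ℝ, (q : ℝ) ≤ L →
        (((Finset.Icc 1 q).filter
            (fun n => n.Coprime q ∧ liouville n ≠ jacobiSym (n : ℤ) q)).card : ℝ)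
          ≤ C * (q : ℝ) ^ ((1 : ℝ) - δ) →
        (∀ n : ℕ, 0 < n → (n : ℝ) ≤ L → n.Coprime q →
          liouville (n + q) = liouville n) →
        ∀ N R : ℝ, 1 ≤ N → 1 ≤ R → (q : ℝ) ≤ N * R → N * R ≤ L →
          (((Finset.range (⌊N⌋₊ + 1)).filter
              (fun p : ℕ => p.Prime ∧ N / 2 < (p : ℝ) ∧ (p : ℝ) ≤ N ∧
                jacobiSym (p : ℤ) q = 1)).card : ℝ) *
          (((Finset.range (⌊R⌋₊ + 1)).filter
              (fun r : ℕ => r.Prime ∧ R / 2 < (r : ℝ) ∧ (r : ℝ) ≤ R ∧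
                jacobiSym (r : ℤ) q = -1)).card : ℝ)
            ≤ C' * R * N * (q : ℝ) ^ (-δ) := by
  refine ⟨2 * C, by positivity, fun q hq δ _ L _ hbad hper N R hN hR hqNR hNRL => ?_⟩
  set B := (Finset.Icc 1 q).filter
    (fun n => n.Coprime q ∧ liouville n ≠ jacobiSym (n : ℤ) q)
  set P := (Finset.range (⌊N⌋₊ + 1)).filter
    (fun p : ℕ => p.Prime ∧ N / 2 < (p : ℝ) ∧ (p : ℝ) ≤ N ∧ jacobiSym (p : ℤ) q = 1)
  set Q := (Finset.range (⌊R⌋₊ + 1)).filter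
    (fun r : ℕ => r.Prime ∧ R / 2 < (r : ℝ) ∧ (r : ℝ) ≤ R ∧ jacobiSym (r : ℤ) q = -1)
  have hmemP : ∀ p ∈ P, p.Prime ∧ (p : ℝ) ≤ N ∧ jacobiSym (p : ℤ) q = 1 := fun p h =>
    have h := (Finset.mem_filter.1 h).2
    ⟨h.1, h.2.2⟩
  have hmemQ : ∀ r ∈ Q, r.Prime ∧ (r : ℝ) ≤ R ∧ jacobiSym (r : ℤ) q = -1 := fun r h =>
    have h := (Finset.mem_filter.1 h).2
    ⟨h.1, h.2.2⟩
  have hq0 : (0 : ℝ) < q := by exact_mod_cast hq.pos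
  have hcard : (P ×ˢ Q).card ≤ (B ×ˢ Finset.range (⌊N * R / q⌋₊ + 1)).card := by
    refine Finset.card_le_card_of_injOn (fun x => (x.1 * x.2 % q, x.1 * x.2 / q)) ?_ ?_
    · rintro ⟨p, r⟩ hx
      obtain ⟨hpP, hrQ⟩ := Finset.mem_product.1 hx
      obtain ⟨hp, hpN, hpχ⟩ := hmemP p hpP
      obtain ⟨hr, hrR, hrχ⟩ := hmemQ r hrQ
      have hprNR : ((p * r : ℕ) : ℝ) ≤ N * R := by
        push_cast
        gcongr
      have hχ : jacobiSym ((p * r % q : ℕ) : ℤ) q = -1 := by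
        rw [Int.natCast_mod, ← jacobiSym.mod_left, Nat.cast_mul, jacobiSym.mul_left, hpχ, hrχ]
        norm_num
      have hcop : (p * r % q).Coprime q := by
        have : NeZero q := ⟨hq.ne_zero⟩
        by_contra hnot
        have h0 := jacobiSym.eq_zero_iff_not_coprime (a := ((p * r % q : ℕ) : ℤ)) (b := q)
        rw [Int.gcd_natCast_natCast] at h0
        rw [h0.2 hnot] at hχ
        norm_num at hχ
      have hpos : 0 < p * r % q := by
        refine Nat.pos_of_ne_zero fun h0 => ?_
        rw [h0, Nat.coprime_zero_left] at hcop
        exact hq.one_lt.ne' hcop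
      have hliou : liouville (p * r % q) = 1 := by
        rw [← liouville_add_mul_of_periodic hper hpos hcop (p * r / q)
          (by rw [Nat.mod_add_div]; exact hprNR.trans hNRL), Nat.mod_add_div]
        exact liouville_prime_mul_prime hp hr
      refine Finset.mem_product.2 ⟨Finset.mem_filter.2 ⟨Finset.mem_Icc.2
        ⟨hpos, (Nat.mod_lt _ hq.pos).le⟩, hcop, ?_⟩, Finset.mem_range.2 (Nat.lt_succ_of_le ?_)⟩
      · rw [hliou, hχ]
        norm_num
      · refine Nat.le_floor (Nat.cast_div_le.trans ?_)
        gcongr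
    · rintro ⟨p, r⟩ hx ⟨p', r'⟩ hx' heq
      obtain ⟨hpP, -⟩ := Finset.mem_product.1 hx
      obtain ⟨hpP', hrQ'⟩ := Finset.mem_product.1 hx'
      obtain ⟨hp, -, hpχ⟩ := hmemP p hpP
      obtain ⟨hr', -, hrχ'⟩ := hmemQ r' hrQ'
      have hne : p ≠ r' := by
        rintro rfl
        rw [hpχ] at hrχ'
        norm_num at hrχ'
      obtain ⟨hmod, hdiv⟩ := Prod.mk.inj heq
      have hmul : p * r = p' * r' := by
        rw [← Nat.mod_add_div (p * r) q, ← Nat.mod_add_div (p' * r') q]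
        exact congrArg₂ (fun a b => a + q * b) hmod hdiv
      obtain ⟨h₁, h₂⟩ := eq_and_eq_of_prime_mul_eq hp (hmemP p' hpP').1 hr' hne hmul
      exact Prod.ext h₁ h₂
  rw [Finset.card_product, Finset.card_product, Finset.card_range] at hcard
  have hquot : 1 ≤ N * R / q := (one_le_div hq0).2 hqNR
  calc (P.card : ℝ) * Q.card ≤ B.card * ((⌊N * R / q⌋₊ : ℝ) + 1) := by exact_mod_cast hcard
    _ ≤ (C * (q : ℝ) ^ (1 - δ)) * (2 * (N * R / q)) := by
        gcongr
        linarith [Nat.floor_le (zero_le_one.trans hquot)]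
    _ = 2 * C * R * N * (q : ℝ) ^ (-δ) := by
        rw [sub_eq_add_neg, Real.rpow_add hq0, Real.rpow_one]
        field_simp
end
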